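/- Let f : {-1,1}^n → [-1,1] be a function of degree at most d. Then ∑_{j=1}^{n} √(Inf_j(f)) ≤ d² e^d. -/

import Mathlib

open Finset

/-- The Walsh character `χ_S(x) = ∏_{k ∈ S} x_k` on the Boolean cube `{-1,1}^n`,
where a point of the cube is encoded as `x : Fin n → Bool` (`true ↦ 1`, `false ↦ -1`). -/
noncomputable def walsh {n : ℕ} (S : Finset (Fin n)) (x : Fin n → Bool) : ℝ :=
  ∏ k ∈ S, (if x k then (1 : ℝ) else -1)

/-- The Fourier–Walsh coefficient `f̂(S) = 2^{-n} ∑_x f(x) χ_S(x)`. -/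
noncomputable def walshCoeff {n : ℕ} (f : (Fin n → Bool) → ℝ) (S : Finset (Fin n)) : ℝ :=
  (∑ x : Fin n → Bool, f x * walsh S x) / 2 ^ n

/-- The variance `Var(f) = ∑_{S ≠ ∅} f̂(S)²`. -/
noncomputable def variance {n : ℕ} (f : (Fin n → Bool) → ℝ) : ℝ :=
  ∑ S ∈ Finset.univ.filter (fun S : Finset (Fin n) => S ≠ ∅), (walshCoeff f S) ^ 2

/-- The influence of coordinate `j`: `Inf_j(f) = ∑_{S ∋ j} f̂(S)²`. -/
noncomputable def influence {n : ℕ} (j : Fin n) (f : (Fin n → Bool) → ℝ) : ℝ :=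
  ∑ S ∈ Finset.univ.filter (fun S : Finset (Fin n) => j ∈ S), (walshCoeff f S) ^ 2

/-- The two-point logarithmic Sobolev inequality, normalized to mean one. -/
lemma two_point_log_sobolev_normalized {t : ℝ} (h0 : 0 ≤ t) (h1 : t ≤ 1) :
    (1 + t) ^ 2 * Real.log (1 + t) + (1 - t) ^ 2 * Real.log (1 - t)
      - (1 + t ^ 2) * Real.log (1 + t ^ 2) - 2 * t ^ 2 ≤ 0 := by
  have hc (u : ℝ → ℝ) (hu : Continuous u) : Continuous fun t => u t * Real.log (u t) :=
    Real.continuous_mul_log.comp hu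
  have hlog {t : ℝ} (ht : t ∈ Set.Ioo (0 : ℝ) 1) :
      HasDerivAt (fun t => Real.log (1 + t)) (1 / (1 + t)) t ∧
      HasDerivAt (fun t => Real.log (1 - t)) (-1 / (1 - t)) t ∧
      HasDerivAt (fun t => Real.log (1 + t ^ 2)) (2 * t / (1 + t ^ 2)) t := by
    obtain ⟨ht0, ht1⟩ := ht
    refine ⟨((hasDerivAt_id t).const_add 1).log (by simp; positivity),
      ((hasDerivAt_id t).const_sub 1).log (by simp; linarith), ?_⟩
    have := (((hasDerivAt_id t).pow 2).const_add 1).log (by simp; positivity)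
    simpa using this
  -- half of the first derivative
  set K : ℝ → ℝ := fun t => (1 + t) * Real.log (1 + t) - (1 - t) * Real.log (1 - t)
    - t * Real.log (1 + t ^ 2) - 2 * t with hK
  have hlogc : Continuous fun t : ℝ => Real.log (1 + t ^ 2) :=
    Continuous.log (by fun_prop) fun t => by positivity
  have hKc : Continuous K :=
    (((hc _ (by fun_prop)).sub (hc _ (by fun_prop))).sub (continuous_id.mul hlogc)).sub
      (by fun_prop)
  have hKneg : ∀ t ∈ Set.Icc (0 : ℝ) 1, K t ≤ 0 := by
    have hanti : AntitoneOn K (Set.Icc 0 1) := by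
      have hd : ∀ t ∈ Set.Ioo (0 : ℝ) 1, HasDerivAt K (Real.log (1 + t) + Real.log (1 - t)
          - Real.log (1 + t ^ 2) - 2 * t ^ 2 / (1 + t ^ 2)) t := by
        intro t ht
        obtain ⟨l1, l2, l3⟩ := hlog ht
        obtain ⟨ht0, ht1⟩ := ht
        have hne1 : 1 + t ≠ 0 := by positivity
        have hne2 : 1 - t ≠ 0 := by linarith
        have hne3 : 1 + t ^ 2 ≠ 0 := by positivity
        convert! ((((((hasDerivAt_id t).const_add 1).mul l1).sub
          (((hasDerivAt_id t).const_sub 1).mul l2)).sub ((hasDerivAt_id t).mul l3)).sub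
          ((hasDerivAt_id t).const_mul 2)) using 1
        simp only [id]
        field_simp
        ring
      refine antitoneOn_of_deriv_nonpos (convex_Icc 0 1) hKc.continuousOn ?_ ?_
      · rw [interior_Icc]
        exact fun t ht => (hd t ht).differentiableAt.differentiableWithinAt
      · rw [interior_Icc]
        intro t ht
        rw [(hd t ht).deriv]
        obtain ⟨ht0, ht1⟩ := ht
        have e1 : Real.log (1 + t) + Real.log (1 - t) ≤ 0 := by
          rw [← Real.log_mul (by positivity) (by linarith)]
          exact Real.log_nonpos (by nlinarith) (by nlinarith)
        have e2 : 0 ≤ Real.log (1 + t ^ 2) := Real.log_nonneg (by nlinarith)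
        have e3 : 0 ≤ 2 * t ^ 2 / (1 + t ^ 2) := by positivity
        linarith
    intro t ht
    simpa [hK] using hanti (Set.left_mem_Icc.2 zero_le_one) ht ht.1
  set H : ℝ → ℝ := fun t => (1 + t) ^ 2 * Real.log (1 + t) + (1 - t) ^ 2 * Real.log (1 - t)
      - (1 + t ^ 2) * Real.log (1 + t ^ 2) - 2 * t ^ 2 with hH
  have hHc : Continuous H := by
    have hsq (u : ℝ → ℝ) (hu : Continuous u) : Continuous fun t => u t ^ 2 * Real.log (u t) :=
      (hu.mul (hc u hu)).congr fun t => by simp only [Pi.mul_apply]; ring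
    exact (((hsq _ (by fun_prop)).add (hsq _ (by fun_prop))).sub (hc _ (by fun_prop))).sub
      (by fun_prop)
  have hanti : AntitoneOn H (Set.Icc 0 1) := by
    have hd : ∀ t ∈ Set.Ioo (0 : ℝ) 1, HasDerivAt H (2 * K t) t := by
      intro t ht
      obtain ⟨l1, l2, l3⟩ := hlog ht
      obtain ⟨ht0, ht1⟩ := ht
      have hne1 : 1 + t ≠ 0 := by positivity
      have hne2 : 1 - t ≠ 0 := by linarith
      have hne3 : 1 + t ^ 2 ≠ 0 := by positivity
      convert! (((((((hasDerivAt_id t).const_add 1).pow 2).mul l1).add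
        ((((hasDerivAt_id t).const_sub 1).pow 2).mul l2)).sub
        ((((hasDerivAt_id t).pow 2).const_add 1).mul l3)).sub
        (((hasDerivAt_id t).pow 2).const_mul 2)) using 1
      simp [hK]
      field_simp
      ring
    refine antitoneOn_of_deriv_nonpos (convex_Icc 0 1) hHc.continuousOn ?_ ?_
    · rw [interior_Icc]
      exact fun t ht => (hd t ht).differentiableAt.differentiableWithinAt
    · rw [interior_Icc]
      intro t ht
      rw [(hd t ht).deriv]
      linarith [hKneg t (Set.Ioo_subset_Icc_self ht)]
  simpa [hH] using hanti (Set.left_mem_Icc.2 zero_le_one) ⟨h0, h1⟩ h0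

/-- The two-point logarithmic Sobolev inequality. -/
lemma two_point_log_sobolev (a b : ℝ) :
    a ^ 2 * Real.log (a ^ 2) + b ^ 2 * Real.log (b ^ 2)
      ≤ (a ^ 2 + b ^ 2) * Real.log ((a ^ 2 + b ^ 2) / 2) + (a - b) ^ 2 := by
  have key : ∀ a b : ℝ, 0 ≤ b → b ≤ a → a ^ 2 * Real.log (a ^ 2) + b ^ 2 * Real.log (b ^ 2)
      ≤ (a ^ 2 + b ^ 2) * Real.log ((a ^ 2 + b ^ 2) / 2) + (a - b) ^ 2 := by
    intro a b hb hab
    rcases (hb.trans hab).eq_or_lt with rfl | ha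
    · obtain rfl : b = 0 := le_antisymm hab hb
      simp
    obtain ⟨s, t, hs, ht0, ht1, rfl, rfl⟩ : ∃ s t : ℝ, 0 < s ∧ 0 ≤ t ∧ t ≤ 1 ∧
        a = s * (1 + t) ∧ b = s * (1 - t) := by
      refine ⟨(a + b) / 2, (a - b) / (a + b), by positivity,
        div_nonneg (by linarith) (by positivity), ?_, ?_, ?_⟩
      · rw [div_le_one (by positivity)]; linarith
      · field_simp; ring
      · field_simp; ring
    have hsq (y : ℝ) : (s * y) ^ 2 * Real.log ((s * y) ^ 2)
        = 2 * s ^ 2 * y ^ 2 * (Real.log s + Real.log y) := by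
      rcases eq_or_ne y 0 with rfl | hy
      · simp
      rw [Real.log_pow, Real.log_mul hs.ne' hy]
      push_cast
      ring
    have hm : ((s * (1 + t)) ^ 2 + (s * (1 - t)) ^ 2) / 2 = s ^ 2 * (1 + t ^ 2) := by ring
    rw [hsq, hsq, hm, Real.log_mul (by positivity) (by positivity), Real.log_pow]
    push_cast
    nlinarith [mul_le_mul_of_nonneg_left (two_point_log_sobolev_normalized ht0 ht1) (sq_nonneg s)]
  have habs : a ^ 2 * Real.log (a ^ 2) + b ^ 2 * Real.log (b ^ 2)
      ≤ (a ^ 2 + b ^ 2) * Real.log ((a ^ 2 + b ^ 2) / 2) + (|a| - |b|) ^ 2 := by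
    rcases le_total |b| |a| with h | h
    · simpa using key |a| |b| (abs_nonneg b) h
    · have := key |b| |a| (abs_nonneg a) h
      simp only [sq_abs] at this
      rw [add_comm (b ^ 2) (a ^ 2)] at this
      nlinarith
  exact habs.trans (add_le_add_right (sq_le_sq.2 (abs_abs_sub_abs_le a b)) _)

lemma sum_cube_succ {n : ℕ} (F : (Fin (n + 1) → Bool) → ℝ) :
    ∑ x, F x = ∑ x : Fin n → Bool, (F (Fin.cons true x) + F (Fin.cons false x)) := by
  rw [← (Fin.consEquiv fun _ => Bool).sum_comp, Fintype.sum_prod_type, Fintype.sum_bool,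
    ← Finset.sum_add_distrib]
  rfl

lemma sq_sqrt_mean_sub_le (a b a' b' : ℝ) :
    (√((a ^ 2 + b ^ 2) / 2) - √((a' ^ 2 + b' ^ 2) / 2)) ^ 2
      ≤ ((a - a') ^ 2 + (b - b') ^ 2) / 2 := by
  have h1 := Real.sq_sqrt (show 0 ≤ (a ^ 2 + b ^ 2) / 2 by positivity)
  have h2 := Real.sq_sqrt (show 0 ≤ (a' ^ 2 + b' ^ 2) / 2 by positivity)
  have h3 : (a * a' + b * b') / 2 ≤ √((a ^ 2 + b ^ 2) / 2) * √((a' ^ 2 + b' ^ 2) / 2) := by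
    rw [← Real.sqrt_mul (by positivity)]
    apply Real.le_sqrt_of_sq_le
    nlinarith [sq_nonneg (a * b' - a' * b)]
  nlinarith

/-- The logarithmic Sobolev inequality on the Boolean cube. -/
theorem log_sobolev_cube {n : ℕ} (g : (Fin n → Bool) → ℝ) :
    ∑ x, g x ^ 2 * Real.log (g x ^ 2) - (∑ x, g x ^ 2) * Real.log ((∑ x, g x ^ 2) / 2 ^ n)
      ≤ (∑ i, ∑ x, (g x - g (Function.update x i (!x i))) ^ 2) / 2 := by
  induction n with
  | zero => simp
  | succ n ih =>
    set a : (Fin n → Bool) → ℝ := fun x => g (Fin.cons true x) with ha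
    set b : (Fin n → Bool) → ℝ := fun x => g (Fin.cons false x) with hb
    set h : (Fin n → Bool) → ℝ := fun x => √((a x ^ 2 + b x ^ 2) / 2) with hh
    have hsq (x) : h x ^ 2 = (a x ^ 2 + b x ^ 2) / 2 := Real.sq_sqrt (by positivity)
    have hsum : ∑ x, g x ^ 2 = 2 * ∑ x, h x ^ 2 := by
      rw [sum_cube_succ, Finset.mul_sum]
      exact Finset.sum_congr rfl fun x _ => by rw [hsq]; ring
    have hent : ∑ x, g x ^ 2 * Real.log (g x ^ 2)
        ≤ 2 * ∑ x, h x ^ 2 * Real.log (h x ^ 2) + ∑ x, (a x - b x) ^ 2 := by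
      rw [sum_cube_succ, Finset.mul_sum, ← Finset.sum_add_distrib]
      refine Finset.sum_le_sum fun x _ => (two_point_log_sobolev (a x) (b x)).trans_eq ?_
      rw [hsq]; ring
    have henergy : (∑ x, (a x - b x) ^ 2)
        + ∑ i, ∑ x, (h x - h (Function.update x i (!x i))) ^ 2
        ≤ (∑ i, ∑ x, (g x - g (Function.update x i (!x i))) ^ 2) / 2 := by
      rw [Fin.sum_univ_succ, add_div]
      refine add_le_add (le_of_eq ?_) ?_
      · rw [sum_cube_succ, Finset.sum_div]
        refine Finset.sum_congr rfl fun x _ => ?_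
        simp only [Fin.update_cons_zero, Fin.cons_zero, Bool.not_true, Bool.not_false, ha, hb]
        ring
      · rw [Finset.sum_div]
        refine Finset.sum_le_sum fun i _ => ?_
        rw [sum_cube_succ, Finset.sum_div]
        refine Finset.sum_le_sum fun x _ => ?_
        simp only [← Fin.cons_update, Fin.cons_succ]
        exact sq_sqrt_mean_sub_le _ _ _ _
    have hscale : 2 * (∑ x, h x ^ 2) / 2 ^ (n + 1) = (∑ x, h x ^ 2) / 2 ^ n := by
      rw [pow_succ]; field_simp
    rw [hsum, hscale]
    linarith [ih h]

/-- A function whose energy is at most `k` times its second moment satisfies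
`‖g‖₂ ≤ e^k ‖g‖₁`. -/
lemma sqrt_mean_sq_le_exp_mul_mean_abs {n : ℕ} (g : (Fin n → Bool) → ℝ) (k : ℝ)
    (hk : (∑ i, ∑ x, (|g x| - |g (Function.update x i (!x i))|) ^ 2) / 2
      ≤ 2 * k * ∑ x, g x ^ 2) :
    √((∑ x, g x ^ 2) / 2 ^ n) ≤ Real.exp k * ((∑ x, |g x|) / 2 ^ n) := by
  set M := (∑ x, g x ^ 2) / 2 ^ n with hM
  have hsum : ∑ x, g x ^ 2 = 2 ^ n * M := by rw [hM]; field_simp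
  have hM0 : 0 ≤ M := by positivity
  rcases hM0.eq_or_lt with h0 | hpos
  · rw [← h0, Real.sqrt_zero]; positivity
  have hls := (log_sobolev_cube fun x => |g x|).trans hk
  simp only [sq_abs, ← hM] at hls
  set s := √M * Real.exp k with hs
  have hs0 : 0 < s := by positivity
  have hlogs : Real.log s = Real.log M / 2 + k := by
    rw [hs, Real.log_mul (by positivity) (by positivity), Real.log_exp, Real.log_sqrt hM0]
  have hpt (x) : g x ^ 2 * Real.log s - g x ^ 2 * Real.log (g x ^ 2) / 2
      ≤ s * |g x| - g x ^ 2 := by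
    rcases eq_or_ne (g x) 0 with h | h
    · simp [h]
    have hg : 0 < |g x| := abs_pos.2 h
    have h1 := Real.log_le_sub_one_of_pos (div_pos hs0 hg)
    rw [Real.log_div hs0.ne' hg.ne', Real.log_abs] at h1
    have h2 := mul_le_mul_of_nonneg_left h1 (sq_nonneg (g x))
    have h3 : g x ^ 2 * (s / |g x| - 1) = s * |g x| - g x ^ 2 := by
      rw [← sq_abs]; field_simp
    rw [Real.log_pow]
    push_cast
    linarith
  have hall := Finset.sum_le_sum fun x (_ : x ∈ Finset.univ) => hpt x
  simp only [Finset.sum_sub_distrib, ← Finset.sum_mul, ← Finset.sum_div, ← Finset.mul_sum] at hall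
  rw [hlogs] at hall
  have hfin : ∑ x, g x ^ 2 ≤ s * ∑ x, |g x| := by nlinarith
  have hMs : M ≤ √M * (Real.exp k * ((∑ x, |g x|) / 2 ^ n)) := by
    rw [hM, div_le_iff₀ (by positivity), ← hM]
    refine hfin.trans_eq ?_
    rw [hs]; field_simp
  have hsq : √M * √M = M := Real.mul_self_sqrt hM0
  exact le_of_mul_le_mul_left (hsq.le.trans hMs) (Real.sqrt_pos.2 hpos)

lemma sum_cube_prod {n : ℕ} (F : Fin n → Bool → ℝ) :
    ∑ x : Fin n → Bool, ∏ k, F k (x k) = ∏ k, (F k true + F k false) := by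
  simp only [← Fintype.sum_bool, Finset.prod_univ_sum, Fintype.piFinset_univ]

lemma sum_walsh_mul_walsh {n : ℕ} (S T : Finset (Fin n)) :
    ∑ x, walsh S x * walsh T x = if S = T then 2 ^ n else 0 := by
  have h (x : Fin n → Bool) : walsh S x * walsh T x = ∏ k,
      (if k ∈ S then (if x k then (1 : ℝ) else -1) else 1)
        * (if k ∈ T then (if x k then (1 : ℝ) else -1) else 1) := by
    rw [Finset.prod_mul_distrib, Finset.prod_ite_mem, Finset.prod_ite_mem, Finset.univ_inter,
      Finset.univ_inter, walsh, walsh]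
  simp only [h]
  rw [sum_cube_prod fun k b => (if k ∈ S then (if b then (1 : ℝ) else -1) else 1)
        * (if k ∈ T then (if b then (1 : ℝ) else -1) else 1)]
  rcases eq_or_ne S T with rfl | hST
  · rw [if_pos rfl, Finset.prod_congr rfl fun k _ => show _ = (2 : ℝ) by
      by_cases h : k ∈ S <;> simp [h] <;> norm_num]
    simp
  · rw [if_neg hST]
    obtain ⟨k, hk⟩ : ∃ k, ¬(k ∈ S ↔ k ∈ T) := by
      by_contra! hcon
      exact hST (Finset.ext hcon)
    refine Finset.prod_eq_zero (Finset.mem_univ k) ?_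
    by_cases h1 : k ∈ S <;> by_cases h2 : k ∈ T <;> simp_all

/-- The function on the cube with Fourier–Walsh coefficients `c`. -/
noncomputable def walshSum {n : ℕ} (c : Finset (Fin n) → ℝ) (x : Fin n → Bool) : ℝ :=
  ∑ S, c S * walsh S x

lemma sum_walshSum_sq {n : ℕ} (c : Finset (Fin n) → ℝ) :
    ∑ x, walshSum c x ^ 2 = 2 ^ n * ∑ S, c S ^ 2 := by
  have h (x : Fin n → Bool) : walshSum c x ^ 2
      = ∑ S, ∑ T, c S * c T * (walsh S x * walsh T x) := by
    rw [walshSum, sq, Finset.sum_mul_sum]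
    exact Finset.sum_congr rfl fun S _ => Finset.sum_congr rfl fun T _ => by ring
  simp only [h]
  rw [Finset.sum_comm, Finset.mul_sum]
  refine Finset.sum_congr rfl fun S _ => ?_
  rw [Finset.sum_comm]
  simp only [← Finset.mul_sum, sum_walsh_mul_walsh]
  simp
  ring

lemma walsh_flip {n : ℕ} (S : Finset (Fin n)) (x : Fin n → Bool) (i : Fin n) :
    walsh S (Function.update x i (!x i)) = (if i ∈ S then -1 else 1) * walsh S x := by
  split_ifs with hi
  · rw [walsh, walsh, ← Finset.mul_prod_erase _ _ hi, ← Finset.mul_prod_erase S _ hi,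
      Finset.prod_congr rfl fun k hk => by
        rw [Function.update_of_ne (Finset.ne_of_mem_erase hk)]]
    cases x i <;> simp
  · rw [walsh, walsh, one_mul]
    refine Finset.prod_congr rfl fun k hk => ?_
    rw [Function.update_of_ne (by rintro rfl; exact hi hk)]

lemma walshSum_sub_flip {n : ℕ} (c : Finset (Fin n) → ℝ) (x : Fin n → Bool) (i : Fin n) :
    walshSum c x - walshSum c (Function.update x i (!x i))
      = 2 * walshSum (fun S => if i ∈ S then c S else 0) x := by
  simp only [walshSum, walsh_flip, Finset.mul_sum, ← Finset.sum_sub_distrib]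
  refine Finset.sum_congr rfl fun S _ => ?_
  split_ifs <;> ring

/-- The discrete derivative `∑_{S ∋ j} f̂(S) χ_S`, up to the sign `x_j`. -/
noncomputable def cubeDeriv {n : ℕ} (j : Fin n) (f : (Fin n → Bool) → ℝ) :
    (Fin n → Bool) → ℝ :=
  walshSum fun S => if j ∈ S then walshCoeff f S else 0

lemma sum_cubeDeriv_sq {n : ℕ} (j : Fin n) (f : (Fin n → Bool) → ℝ) :
    ∑ x, cubeDeriv j f x ^ 2 = 2 ^ n * influence j f := by
  rw [cubeDeriv, sum_walshSum_sq, influence, Finset.sum_filter]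
  congr 1
  refine Finset.sum_congr rfl fun S _ => ?_
  split_ifs <;> simp

lemma abs_cubeDeriv_flip_self {n : ℕ} (j : Fin n) (f : (Fin n → Bool) → ℝ) (x : Fin n → Bool) :
    |cubeDeriv j f (Function.update x j (!x j))| = |cubeDeriv j f x| := by
  have h := walshSum_sub_flip (fun S => if j ∈ S then walshCoeff f S else 0) x j
  have h2 : (fun S => if j ∈ S then (if j ∈ S then walshCoeff f S else 0) else 0)
      = fun S => if j ∈ S then walshCoeff f S else 0 := by
    funext S; split_ifs <;> rfl
  rw [h2] at h
  change cubeDeriv j f x - cubeDeriv j f _ = 2 * cubeDeriv j f x at h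
  rw [← abs_neg]
  congr 1
  linarith

lemma cubeDeriv_energy_le {d n : ℕ} (f : (Fin n → Bool) → ℝ)
    (hdeg : ∀ S : Finset (Fin n), d < S.card → walshCoeff f S = 0) (j : Fin n) :
    (∑ i, ∑ x, (|cubeDeriv j f x| - |cubeDeriv j f (Function.update x i (!x i))|) ^ 2) / 2
      ≤ 2 * ((d : ℝ) - 1) * ∑ x, cubeDeriv j f x ^ 2 := by
  set c : Finset (Fin n) → ℝ := fun S => if j ∈ S then walshCoeff f S else 0 with hc
  have hg : cubeDeriv j f = walshSum c := rfl
  have hi : ∀ i, ∑ x, (|cubeDeriv j f x| - |cubeDeriv j f (Function.update x i (!x i))|) ^ 2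
      ≤ 4 * 2 ^ n * ∑ S, (if i ∈ S.erase j then c S ^ 2 else 0) := by
    intro i
    rcases eq_or_ne i j with rfl | hij
    · simp [abs_cubeDeriv_flip_self]
    calc _ ≤ ∑ x, (2 * walshSum (fun S => if i ∈ S then c S else 0) x) ^ 2 := by
          refine Finset.sum_le_sum fun x _ => ?_
          rw [← walshSum_sub_flip, hg]
          exact sq_le_sq.2 (abs_abs_sub_abs_le _ _)
      _ = _ := by
          simp only [mul_pow, ← Finset.mul_sum, sum_walshSum_sq]
          rw [← mul_assoc, show (2 : ℝ) ^ 2 = 4 by norm_num]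
          refine congrArg _ (Finset.sum_congr rfl fun S _ => ?_)
          simp [hij]
  have hcard : ∀ S, ∑ i, (if i ∈ S.erase j then c S ^ 2 else 0) ≤ ((d : ℝ) - 1) * c S ^ 2 := by
    intro S
    rw [Finset.sum_ite_mem, Finset.univ_inter, Finset.sum_const, nsmul_eq_mul]
    by_cases hj : j ∈ S
    · rcases lt_or_ge d S.card with h | h
      · simp [hc, hdeg S h]
      · have h1 : ((S.erase j).card : ℝ) + 1 = S.card := by
          exact_mod_cast Finset.card_erase_add_one hj
        have h2 : (S.card : ℝ) ≤ d := by exact_mod_cast h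
        exact mul_le_mul_of_nonneg_right (by linarith) (sq_nonneg _)
    · simp [hc, hj]
  have htot := Finset.sum_le_sum fun i (_ : i ∈ Finset.univ) => hi i
  rw [← Finset.mul_sum, Finset.sum_comm (f := fun i S => if i ∈ S.erase j then c S ^ 2 else 0)]
    at htot
  have hS := Finset.sum_le_sum fun S (_ : S ∈ Finset.univ) => hcard S
  rw [← Finset.mul_sum] at hS
  rw [hg, sum_walshSum_sq, ← hg]
  have h2n : (0 : ℝ) < 2 ^ n := by positivity
  nlinarith [mul_le_mul_of_nonneg_left hS h2n.le]

/-- The multilinear extension of a function bounded by one is bounded by one on the solid cube. -/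
lemma abs_multilinear_extension_le_one {n : ℕ} {f : (Fin n → Bool) → ℝ}
    (hf : ∀ x, |f x| ≤ 1) {v : Fin n → ℝ} (hv : ∀ k, |v k| ≤ 1) :
    |∑ S, walshCoeff f S * ∏ k ∈ S, v k| ≤ 1 := by
  set w : (Fin n → Bool) → ℝ := fun y => ∏ k, (1 + v k * (if y k then (1 : ℝ) else -1)) with hw
  have hw0 (y) : 0 ≤ w y := by
    refine Finset.prod_nonneg fun k _ => ?_
    have := abs_le.1 (hv k)
    split_ifs <;> linarith
  have hw1 : ∑ y, w y = 2 ^ n := by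
    rw [hw, sum_cube_prod fun k b => 1 + v k * (if b then (1 : ℝ) else -1),
      Finset.prod_congr rfl fun k _ => show _ = (2 : ℝ) by simp; ring]
    simp
  have hker : ∑ S, walshCoeff f S * ∏ k ∈ S, v k = (∑ y, f y * w y) / 2 ^ n := by
    simp only [walshCoeff, div_mul_eq_mul_div, ← Finset.sum_div, Finset.sum_mul]
    rw [Finset.sum_comm]
    congr 1
    refine Finset.sum_congr rfl fun y _ => ?_
    rw [hw]
    simp only [Finset.prod_one_add, Finset.powerset_univ, Finset.mul_sum, Finset.prod_mul_distrib]
    exact Finset.sum_congr rfl fun S _ => by rw [walsh]; ring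
  rw [hker, abs_div, abs_of_pos (show (0 : ℝ) < 2 ^ n by positivity), div_le_one (by positivity),
    ← hw1]
  refine (Finset.abs_sum_le_sum_abs _ _).trans (Finset.sum_le_sum fun y _ => ?_)
  rw [abs_mul, abs_of_nonneg (hw0 y)]
  exact mul_le_of_le_one_left (hw0 y) (hf y)

open Polynomial in
/-- Markov's inequality at the endpoint `1`. -/
lemma abs_derivative_eval_one_le {d : ℕ} {P : ℝ[X]} (hdeg : P.degree ≤ d)
    (hP : ∀ x ∈ Set.Icc (-1 : ℝ) 1, |P.eval x| ≤ 1) : |P.derivative.eval 1| ≤ (d : ℝ) ^ 2 := by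
  have hT : (derivative^[1] (Chebyshev.T ℝ d)).eval 1 = (d : ℝ) ^ 2 := by
    have := Chebyshev.iterate_derivative_T_eval_one_recurrence (R := ℝ) d 0
    simpa using this
  have key : ∀ Q : ℝ[X], Q.degree ≤ d → (∀ x ∈ Set.Icc (-1 : ℝ) 1, |Q.eval x| ≤ 1) →
      Q.derivative.eval 1 ≤ (d : ℝ) ^ 2 := fun Q h1 h2 =>
    (Chebyshev.eval_iterate_derivative_le_of_forall_abs_le_one (k := 1) le_rfl h1 h2).trans_eq hT
  refine abs_le.2 ⟨?_, key P hdeg hP⟩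
  have := key (-P) (by rwa [degree_neg]) (by simpa using hP)
  rw [derivative_neg, eval_neg] at this
  linarith

open Polynomial in
lemma abs_sum_cubeDeriv_le {d n : ℕ} {f : (Fin n → Bool) → ℝ} (hf : ∀ x, |f x| ≤ 1)
    (hdeg : ∀ S : Finset (Fin n), d < S.card → walshCoeff f S = 0)
    (J : Finset (Fin n)) (x : Fin n → Bool) :
    |∑ j ∈ J, cubeDeriv j f x| ≤ (d : ℝ) ^ 2 := by
  set P : ℝ[X] := ∑ S, C (walshCoeff f S * walsh S x) * X ^ (S ∩ J).card with hP
  have hPdeg : P.degree ≤ d := by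
    refine (degree_sum_le _ _).trans (Finset.sup_le fun S _ => ?_)
    rcases lt_or_ge d S.card with h | h
    · simp [hdeg S h]
    · refine (degree_C_mul_X_pow_le _ _).trans ?_
      exact_mod_cast (Finset.card_le_card Finset.inter_subset_left).trans h
  have hbd : ∀ u ∈ Set.Icc (-1 : ℝ) 1, |P.eval u| ≤ 1 := by
    intro u hu
    have hv : ∀ k, |(if x k then (1 : ℝ) else -1) * (if k ∈ J then u else 1)| ≤ 1 := by
      intro k
      have := abs_le.2 hu
      split_ifs <;> simp [this]
    convert abs_multilinear_extension_le_one hf hv using 2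
    rw [hP, eval_finsetSum]
    refine Finset.sum_congr rfl fun S _ => ?_
    rw [Finset.prod_mul_distrib, Finset.prod_ite_mem, Finset.prod_const, eval_mul, eval_C,
      eval_pow, eval_X, walsh, mul_assoc]
  have hder : P.derivative.eval 1 = ∑ j ∈ J, cubeDeriv j f x := by
    simp only [cubeDeriv, walshSum]
    rw [Finset.sum_comm, hP, derivative_sum, eval_finsetSum]
    refine Finset.sum_congr rfl fun S _ => ?_
    simp only [ite_mul, zero_mul, Finset.sum_ite_mem, Finset.sum_const, nsmul_eq_mul,
      Finset.inter_comm J S]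
    simp [derivative_X_pow]
    ring
  rw [← hder]
  exact abs_derivative_eval_one_le hPdeg hbd

lemma sum_abs_cubeDeriv_le {d n : ℕ} {f : (Fin n → Bool) → ℝ} (hf : ∀ x, |f x| ≤ 1)
    (hdeg : ∀ S : Finset (Fin n), d < S.card → walshCoeff f S = 0) (x : Fin n → Bool) :
    ∑ j, |cubeDeriv j f x| ≤ 2 * (d : ℝ) ^ 2 := by
  rw [← Finset.sum_filter_add_sum_filter_not Finset.univ (fun j => 0 ≤ cubeDeriv j f x),
    Finset.sum_congr rfl fun j hj => abs_of_nonneg (Finset.mem_filter.1 hj).2,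
    Finset.sum_congr (s₁ := Finset.univ.filter fun j => ¬ 0 ≤ cubeDeriv j f x) rfl
      fun j hj => abs_of_neg (not_le.1 (Finset.mem_filter.1 hj).2), Finset.sum_neg_distrib]
  have h1 := (abs_le.1 (abs_sum_cubeDeriv_le hf hdeg
    (Finset.univ.filter fun j => 0 ≤ cubeDeriv j f x) x)).2
  have h2 := (abs_le.1 (abs_sum_cubeDeriv_le hf hdeg
    (Finset.univ.filter fun j => ¬ 0 ≤ cubeDeriv j f x) x)).1
  linarith

/-- For a function `f : {-1,1}^n → [-1,1]` of degree at most `d`,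
`∑_{j=1}^n √(Inf_j(f)) ≤ d² e^d`. -/
theorem sum_sqrt_influences_le (d n : ℕ) (f : (Fin n → Bool) → ℝ)
    (hrange : ∀ x, f x ∈ Set.Icc (-1 : ℝ) 1)
    (hdeg : ∀ S : Finset (Fin n), d < S.card → walshCoeff f S = 0) :
    ∑ j : Fin n, Real.sqrt (influence j f) ≤ (d : ℝ) ^ 2 * Real.exp d := by
  have hf : ∀ x, |f x| ≤ 1 := fun x => abs_le.2 (hrange x)
  have h2n : (0 : ℝ) < 2 ^ n := by positivity
  have hj (j : Fin n) : √(influence j f)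
      ≤ Real.exp ((d : ℝ) - 1) * ((∑ x, |cubeDeriv j f x|) / 2 ^ n) := by
    have h := sqrt_mean_sq_le_exp_mul_mean_abs _ _ (cubeDeriv_energy_le f hdeg j)
    rwa [sum_cubeDeriv_sq, mul_div_cancel_left₀ _ h2n.ne'] at h
  have hL1 : ∑ j, (∑ x, |cubeDeriv j f x|) / 2 ^ n ≤ 2 * (d : ℝ) ^ 2 := by
    rw [← Finset.sum_div, Finset.sum_comm, div_le_iff₀ h2n]
    refine (Finset.sum_le_sum fun x _ => sum_abs_cubeDeriv_le hf hdeg x).trans_eq ?_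
    simp [mul_comm]
  have he : 2 * Real.exp ((d : ℝ) - 1) ≤ Real.exp d := by
    have h1 : Real.exp d = Real.exp ((d : ℝ) - 1) * Real.exp 1 := by
      rw [← Real.exp_add]; congr 1; ring
    have h2 : (2 : ℝ) ≤ Real.exp 1 := by linarith [Real.add_one_le_exp (1 : ℝ)]
    rw [h1, mul_comm]
    exact mul_le_mul_of_nonneg_left h2 (Real.exp_pos _).le
  calc ∑ j, √(influence j f)
      ≤ Real.exp ((d : ℝ) - 1) * ∑ j, (∑ x, |cubeDeriv j f x|) / 2 ^ n := by
        rw [Finset.mul_sum]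
        exact Finset.sum_le_sum fun j _ => hj j
    _ ≤ Real.exp ((d : ℝ) - 1) * (2 * (d : ℝ) ^ 2) :=
        mul_le_mul_of_nonneg_left hL1 (Real.exp_pos _).le
    _ ≤ (d : ℝ) ^ 2 * Real.exp d := by
        nlinarith [mul_le_mul_of_nonneg_left he (sq_nonneg (d : ℝ))]
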